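/- Let 0 < p < 4 and ω² = p/4 with ω ∈ (−1,1). Then the map λ ↦ ∫_ℝ φ_λ(x)² dx (λ ∈ (−1,1)) is differentiable at λ = ω with derivative equal to −(1/ω)·∫_ℝ φ_ω(x)² dx. Consequently ⟨S_ω''(Φ_ω)ψ_ω, ψ_ω⟩ = (1/(4ω))·(d/dλ)∫_ℝ φ_λ² dx |_{λ=ω} = −(1/(4ω²))·∫_ℝ φ_ω² dx < 0, where ψ_ω = (1/(2ω))·(∂_ωφ_ω, −ω·∂_ωφ_ω). -/

import Mathlib

open MeasureTheory Real Filter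

/-- The explicit ground state `φ_ω` of `-φ'' + (1-ω²)φ = φ^{p+1}`. -/
noncomputable def phi (p ω : ℝ) : ℝ → ℝ := fun x =>
  ((p + 2) * (1 - ω ^ 2) / 2) ^ (1 / p) *
    Real.cosh (p / 2 * Real.sqrt (1 - ω ^ 2) * x) ^ (-(2 / p))

/-- `∂_ωφ_ω(x)` : derivative of `λ ↦ φ_λ(x)` at `λ = ω`. -/
noncomputable def dphi (p ω : ℝ) (x : ℝ) : ℝ := deriv (fun m : ℝ => phi p m x) ω

/-- First component of `ψ_ω = (1/(2ω))(∂_ωφ_ω, -ω ∂_ωφ_ω)`. -/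
noncomputable def psi1 (p ω : ℝ) (x : ℝ) : ℝ := 1 / (2 * ω) * dphi p ω x

/-- Second component of `ψ_ω`. -/
noncomputable def psi2 (p ω : ℝ) (x : ℝ) : ℝ := 1 / (2 * ω) * (-ω * dphi p ω x)

/-- Quadratic form of the Hessian `S_ω''(Φ_ω)` evaluated at `ψ_ω`. -/
noncomputable def Bpsi (p ω : ℝ) : ℝ :=
  ∫ x : ℝ, ((deriv (psi1 p ω) x) ^ 2 + (psi1 p ω x) ^ 2
    - (p + 1) * (phi p ω x) ^ p * (psi1 p ω x) ^ 2
    + 2 * ω * psi1 p ω x * psi2 p ω x + (psi2 p ω x) ^ 2)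

/-- The ground state `φ_0`, up to its amplitude. -/
noncomputable def profile (p y : ℝ) : ℝ := Real.cosh (p / 2 * y) ^ (-(2 / p))

theorem hasDerivAt_tanh (x : ℝ) : HasDerivAt Real.tanh (1 - Real.tanh x ^ 2) x := by
  have hc : Real.cosh x ≠ 0 := (Real.cosh_pos x).ne'
  have h := (Real.hasDerivAt_sinh x).div (Real.hasDerivAt_cosh x) hc
  have he : Real.tanh = fun y => Real.sinh y / Real.cosh y := by
    ext y; exact Real.tanh_eq_sinh_div_cosh y
  rw [he]
  refine h.congr_deriv ?_
  field_simp

theorem profile_pos (p y : ℝ) : 0 < profile p y := by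
  unfold profile
  have := Real.cosh_pos (p / 2 * y)
  positivity

theorem hasDerivAt_profile {p : ℝ} (hp : p ≠ 0) (y : ℝ) :
    HasDerivAt (profile p) (-(Real.tanh (p / 2 * y)) * profile p y) y := by
  have hc := Real.cosh_pos (p / 2 * y)
  have h := (((hasDerivAt_id y).const_mul (p / 2)).cosh).rpow_const (p := -(2 / p))
    (Or.inl hc.ne')
  refine h.congr_deriv ?_
  simp only [id, profile, Real.tanh_eq_sinh_div_cosh]
  rw [Real.rpow_sub_one hc.ne']
  field_simp

theorem continuous_profile {p : ℝ} (hp : p ≠ 0) : Continuous (profile p) :=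
  continuous_iff_continuousAt.2 fun y => (hasDerivAt_profile hp y).continuousAt

theorem profile_rpow {p : ℝ} (hp : p ≠ 0) (y : ℝ) :
    profile p y ^ p = 1 - Real.tanh (p / 2 * y) ^ 2 := by
  have hc := Real.cosh_pos (p / 2 * y)
  unfold profile
  rw [← Real.rpow_mul hc.le, show -(2 / p) * p = -(2 : ℕ) by field_simp; norm_num,
    Real.rpow_neg hc.le, Real.rpow_natCast, Real.tanh_eq_sinh_div_cosh]
  have := Real.cosh_sq (p / 2 * y)
  generalize p / 2 * y = z at *
  field_simp
  linarith

theorem profile_le {p : ℝ} (hp : 0 < p) (y : ℝ) :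
    profile p y ≤ 2 ^ (2 / p) * Real.exp (-|y|) := by
  have h1 : Real.exp (p / 2 * |y|) / 2 ≤ Real.cosh (p / 2 * y) := by
    rw [← Real.cosh_abs, abs_mul, abs_of_pos (half_pos hp), Real.cosh_eq]
    have := Real.exp_pos (-(p / 2 * |y|))
    linarith
  have h2 := Real.rpow_le_rpow_of_nonpos (by positivity) h1
    (show -(2 / p) ≤ 0 by have := div_pos two_pos hp; linarith)
  refine h2.trans_eq ?_
  rw [Real.div_rpow (Real.exp_pos _).le two_pos.le, ← Real.exp_mul, Real.rpow_neg two_pos.le,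
    div_inv_eq_mul, mul_comm]
  congr 2
  field_simp

theorem integrable_exp_neg_mul_abs {b : ℝ} (hb : 0 < b) :
    Integrable fun x : ℝ => Real.exp (-(b * |x|)) := by
  rw [← integrableOn_univ, ← Set.Iic_union_Ioi (a := (0 : ℝ)), integrableOn_union]
  constructor
  · refine (integrableOn_exp_mul_Iic hb 0).congr_fun (fun x hx => ?_) measurableSet_Iic
    simp only [abs_of_nonpos (Set.mem_Iic.1 hx)]
    ring_nf
  · refine (exp_neg_integrableOn_Ioi 0 hb).congr_fun (fun x hx => ?_) measurableSet_Ioi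
    simp only [abs_of_pos (Set.mem_Ioi.1 hx)]
    ring_nf

theorem integrable_pow_mul_profile_sq {p s : ℝ} (hp : 0 < p) (hs : 0 < s) (n : ℕ) :
    Integrable fun x : ℝ => x ^ n * profile p (s * x) ^ 2 := by
  have hcont := continuous_profile hp.ne'
  refine ((integrable_exp_neg_mul_abs hs).const_mul
    (n.factorial / s ^ n * (2 ^ (2 / p)) ^ 2)).mono'
    (by fun_prop : Continuous _).aestronglyMeasurable (ae_of_all _ fun x => ?_)
  have h1 := Real.pow_div_factorial_le_exp (s * |x|) (by positivity) n
  have h2 := pow_le_pow_left₀ (profile_pos p (s * x)).le (profile_le hp (s * x)) 2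
  rw [abs_mul, abs_of_pos hs] at h2
  have h3 : |x| ^ n ≤ n.factorial / s ^ n * Real.exp (s * |x|) := by
    rw [div_le_iff₀ (by positivity), mul_pow] at h1
    rw [div_mul_eq_mul_div, le_div_iff₀ (by positivity)]
    linarith
  rw [Real.norm_eq_abs, abs_mul, abs_pow, abs_of_nonneg (sq_nonneg (profile p (s * x)))]
  refine (mul_le_mul h3 h2 (by positivity) (by positivity)).trans_eq ?_
  rw [mul_pow, ← Real.exp_nat_mul]
  have : Real.exp (s * |x|) * Real.exp ((2 : ℕ) * -(s * |x|)) = Real.exp (-(s * |x|)) := by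
    rw [← Real.exp_add]; congr 1; push_cast; ring
  rw [← this]
  ring

theorem integrable_pow_mul_tanh_mul_profile_sq {p s : ℝ} (hp : 0 < p) (hs : 0 < s) (n : ℕ)
    {b : ℝ → ℝ} (hb : Continuous b) :
    Integrable fun x : ℝ =>
      b (Real.tanh (p / 2 * (s * x))) * (x ^ n * profile p (s * x) ^ 2) := by
  obtain ⟨C, hC⟩ := (isCompact_Icc (a := (-1 : ℝ)) (b := 1)).exists_bound_of_continuousOn
    hb.continuousOn
  have ht : Continuous Real.tanh :=
    continuous_iff_continuousAt.2 fun y => (hasDerivAt_tanh y).continuousAt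
  refine (integrable_pow_mul_profile_sq hp hs n).bdd_mul (c := C)
    (by fun_prop : Continuous _).aestronglyMeasurable (ae_of_all _ fun x => hC _ ?_)
  exact ⟨(Real.neg_one_lt_tanh _).le, (Real.tanh_lt_one _).le⟩

theorem integrable_quadratic_mul_profile_sq {p s : ℝ} (hp : 0 < p) (hs : 0 < s)
    {b₀ b₁ b₂ : ℝ → ℝ} (h₀ : Continuous b₀) (h₁ : Continuous b₁) (h₂ : Continuous b₂) :
    Integrable fun x : ℝ => (b₀ (Real.tanh (p / 2 * (s * x)))
      + b₁ (Real.tanh (p / 2 * (s * x))) * x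
      + b₂ (Real.tanh (p / 2 * (s * x))) * x ^ 2) * profile p (s * x) ^ 2 := by
  refine (((integrable_pow_mul_tanh_mul_profile_sq hp hs 0 h₀).add
    (integrable_pow_mul_tanh_mul_profile_sq hp hs 1 h₁)).add
    (integrable_pow_mul_tanh_mul_profile_sq hp hs 2 h₂)).congr (ae_of_all _ fun x => ?_)
  simp only [Pi.add_apply]
  ring

theorem phi_eq (p l x : ℝ) :
    phi p l x = ((p + 2) * (1 - l ^ 2) / 2) ^ (1 / p) * profile p (√(1 - l ^ 2) * x) := by
  simp only [phi, profile, mul_assoc]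

theorem phi_rpow {p l : ℝ} (hp : 0 < p) (hl : 0 < 1 - l ^ 2) (x : ℝ) :
    phi p l x ^ p =
      (p + 2) * (1 - l ^ 2) / 2 * (1 - Real.tanh (p / 2 * (√(1 - l ^ 2) * x)) ^ 2) := by
  rw [phi_eq, Real.mul_rpow (by positivity) (profile_pos _ _).le, profile_rpow hp.ne',
    ← Real.rpow_mul (by positivity), one_div_mul_cancel hp.ne', Real.rpow_one]

theorem hasDerivAt_amplitude {p l : ℝ} (hp : 0 < p) (hl : 0 < 1 - l ^ 2) :
    HasDerivAt (fun m : ℝ => ((p + 2) * (1 - m ^ 2) / 2) ^ (1 / p))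
      (-(2 * l / (p * (1 - l ^ 2))) * ((p + 2) * (1 - l ^ 2) / 2) ^ (1 / p)) l := by
  have hb : (p + 2) * (1 - l ^ 2) / 2 ≠ 0 := by positivity
  have h := (((((hasDerivAt_id' l).fun_pow 2).const_sub 1).const_mul (p + 2)).div_const 2).rpow_const
    (p := 1 / p) (Or.inl hb)
  refine h.congr_deriv ?_
  rw [Real.rpow_sub_one hb]
  field_simp
  norm_num

theorem hasDerivAt_sqrt_one_sub_sq {l : ℝ} (hl : 0 < 1 - l ^ 2) :
    HasDerivAt (fun m : ℝ => √(1 - m ^ 2)) (-(l / √(1 - l ^ 2))) l := by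
  have h := (((hasDerivAt_id' l).fun_pow 2).const_sub 1).sqrt (by simpa using hl.ne')
  refine h.congr_deriv ?_
  field_simp
  norm_num

theorem dphi_eq {p l : ℝ} (hp : 0 < p) (hl : 0 < 1 - l ^ 2) (x : ℝ) :
    dphi p l x = -(l / (1 - l ^ 2)) * (2 / p
      - √(1 - l ^ 2) * x * Real.tanh (p / 2 * (√(1 - l ^ 2) * x))) * phi p l x := by
  have hs := Real.sqrt_pos.2 hl
  have h := (hasDerivAt_amplitude hp hl).mul
    ((hasDerivAt_profile hp.ne' (√(1 - l ^ 2) * x)).comp l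
      ((hasDerivAt_sqrt_one_sub_sq hl).mul_const x))
  unfold dphi
  refine (h.congr_of_eventuallyEq (.of_forall fun m => phi_eq p m x)).deriv.trans ?_
  rw [phi_eq]
  have hsq := Real.sq_sqrt hl.le
  simp only [Function.comp_apply]
  generalize √(1 - l ^ 2) = s at *
  rw [← hsq]
  field_simp
  ring

theorem integrable_phi_sq {p l : ℝ} (hp : 0 < p) (hl : 0 < 1 - l ^ 2) :
    Integrable fun x => phi p l x ^ 2 := by
  refine ((integrable_pow_mul_profile_sq hp (Real.sqrt_pos.2 hl) 0).const_mul
    ((((p + 2) * (1 - l ^ 2) / 2) ^ (1 / p)) ^ 2)).congr (ae_of_all _ fun x => ?_)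
  simp only [phi_eq]
  ring

theorem integral_phi_sq {p l : ℝ} (hl : 0 < 1 - l ^ 2) :
    ∫ x, phi p l x ^ 2 = (((p + 2) * (1 - l ^ 2) / 2) ^ (1 / p)) ^ 2 * (√(1 - l ^ 2))⁻¹ *
      ∫ y, profile p y ^ 2 := by
  have h := Measure.integral_comp_mul_left (fun y => profile p y ^ 2) (√(1 - l ^ 2))
  simp only [phi_eq, mul_pow, integral_const_mul, h, smul_eq_mul]
  rw [abs_of_pos (inv_pos.2 (Real.sqrt_pos.2 hl)), mul_assoc]

theorem hasDerivAt_integral_phi_sq {p l : ℝ} (hp : 0 < p) (hl : 0 < 1 - l ^ 2) :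
    HasDerivAt (fun m : ℝ => ∫ x, phi p m x ^ 2)
      (-(l * (4 - p) / (p * (1 - l ^ 2))) * ∫ x, phi p l x ^ 2) l := by
  have hs := Real.sqrt_pos.2 hl
  have h := (((hasDerivAt_amplitude hp hl).fun_pow 2).fun_mul
    ((hasDerivAt_sqrt_one_sub_sq hl).fun_inv hs.ne')).mul_const (∫ y, profile p y ^ 2)
  have hev : ∀ᶠ m in nhds l, 0 < 1 - m ^ 2 :=
    (by fun_prop : Continuous fun m : ℝ => 1 - m ^ 2).continuousAt.eventually (lt_mem_nhds hl)
  refine (h.congr_of_eventuallyEq (hev.mono fun m hm => integral_phi_sq hm)).congr_deriv ?_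
  rw [integral_phi_sq hl]
  have hsq := Real.sq_sqrt hl.le
  generalize ((p + 2) * (1 - l ^ 2) / 2) ^ (1 / p) = M
  generalize √(1 - l ^ 2) = s at *
  rw [← hsq]
  field_simp
  ring

theorem hasDerivAt_phi {p l : ℝ} (hp : 0 < p) (x : ℝ) :
    HasDerivAt (phi p l)
      (-(√(1 - l ^ 2) * Real.tanh (p / 2 * (√(1 - l ^ 2) * x))) * phi p l x) x := by
  have h := ((hasDerivAt_profile hp.ne' (√(1 - l ^ 2) * x)).comp x
    ((hasDerivAt_id x).const_mul (√(1 - l ^ 2)))).const_mul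
    (((p + 2) * (1 - l ^ 2) / 2) ^ (1 / p))
  have he : phi p l = fun x => ((p + 2) * (1 - l ^ 2) / 2) ^ (1 / p) *
      profile p (√(1 - l ^ 2) * x) := funext fun x => phi_eq p l x
  rw [he]
  refine h.congr_deriv ?_
  ring

theorem psi1_eq {p ω : ℝ} (hp : 0 < p) (hω : ω ≠ 0) (hc : 0 < 1 - ω ^ 2) :
    psi1 p ω = fun x => -(1 / (2 * (1 - ω ^ 2))) * ((2 / p
      - √(1 - ω ^ 2) * x * Real.tanh (p / 2 * (√(1 - ω ^ 2) * x))) * phi p ω x) := by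
  ext x
  rw [psi1, dphi_eq hp hc]
  field_simp

theorem hasDerivAt_tanh_mul (a s x : ℝ) :
    HasDerivAt (fun x => Real.tanh (a * (s * x)))
      (a * s * (1 - Real.tanh (a * (s * x)) ^ 2)) x := by
  refine ((hasDerivAt_tanh (a * (s * x))).comp x
    (((hasDerivAt_id' x).const_mul s).const_mul a)).congr_deriv ?_
  ring

theorem hasDerivAt_psi1 {p ω : ℝ} (hp : 0 < p) (hω : ω ≠ 0) (hc : 0 < 1 - ω ^ 2)
    {s T : ℝ} (x : ℝ) (hs : s = √(1 - ω ^ 2)) (hT : T = Real.tanh (p / 2 * (s * x))) :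
    HasDerivAt (psi1 p ω) (-(1 / (2 * s ^ 2)) *
      ((-(s * T) - p / 2 * s ^ 2 * x * (1 - T ^ 2) - s * T * (2 / p - s * x * T))
        * phi p ω x)) x := by
  rw [psi1_eq hp hω hc]
  have hsq := Real.sq_sqrt hc.le
  refine (((((((hasDerivAt_id' x).const_mul (√(1 - ω ^ 2))).fun_mul
    (hasDerivAt_tanh_mul (p / 2) (√(1 - ω ^ 2)) x)).const_sub (2 / p)).fun_mul
    (hasDerivAt_phi hp x)).const_mul (-(1 / (2 * (1 - ω ^ 2)))))).congr_deriv ?_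
  rw [hT, hs, hsq]
  ring_nf
  rw [hsq]
  ring

/-- The Hessian form at `ψ_ω` is the integral of a multiple of `φ_ω²` plus the derivative of
`ψ ψ' - x φ_ω² / (4 (1 - ω²))`, where `ψ` is the first component of `ψ_ω`. -/
theorem Bpsi_eq {p ω : ℝ} (hp : 0 < p) (hω : ω ≠ 0) (hc : 0 < 1 - ω ^ 2) :
    Bpsi p ω = -((4 - p) / (4 * p * (1 - ω ^ 2))) * ∫ x, phi p ω x ^ 2 := by
  obtain ⟨s, hs⟩ : ∃ s, s = √(1 - ω ^ 2) := ⟨_, rfl⟩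
  have hs0 : 0 < s := hs ▸ Real.sqrt_pos.2 hc
  have hsq : s ^ 2 = 1 - ω ^ 2 := hs ▸ Real.sq_sqrt hc.le
  have hphi : ∀ x, HasDerivAt (phi p ω) (-(s * Real.tanh (p / 2 * (s * x))) * phi p ω x) x := by
    intro x; rw [hs]; exact hasDerivAt_phi hp x
  have hint : ∀ {b₀ b₁ b₂ : ℝ → ℝ}, Continuous b₀ → Continuous b₁ → Continuous b₂ →
      Integrable fun x : ℝ => (b₀ (Real.tanh (p / 2 * (s * x)))
        + b₁ (Real.tanh (p / 2 * (s * x))) * x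
        + b₂ (Real.tanh (p / 2 * (s * x))) * x ^ 2) * phi p ω x ^ 2 := by
    intro b₀ b₁ b₂ h₀ h₁ h₂
    refine ((integrable_quadratic_mul_profile_sq hp hs0 h₀ h₁ h₂).const_mul
      ((((p + 2) * (1 - ω ^ 2) / 2) ^ (1 / p)) ^ 2)).congr (ae_of_all _ fun x => ?_)
    simp only [phi_eq, ← hs]
    ring
  set G : ℝ → ℝ := fun x => (1 / (4 * s ^ 4) *
    ((2 / p - s * x * Real.tanh (p / 2 * (s * x))) *
      (-(s * Real.tanh (p / 2 * (s * x)))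
        - p / 2 * s ^ 2 * x * (1 - Real.tanh (p / 2 * (s * x)) ^ 2)
        - s * Real.tanh (p / 2 * (s * x)) * (2 / p - s * x * Real.tanh (p / 2 * (s * x)))))
      - x / (4 * s ^ 2)) * phi p ω x ^ 2 with hG
  set G' : ℝ → ℝ := fun x => (1 / (4 * s ^ 4) *
    ((-(s * Real.tanh (p / 2 * (s * x)))
        - p / 2 * s ^ 2 * x * (1 - Real.tanh (p / 2 * (s * x)) ^ 2)
        - s * Real.tanh (p / 2 * (s * x)) * (2 / p - s * x * Real.tanh (p / 2 * (s * x)))) ^ 2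
      + s ^ 2 * (1 - (p + 1) * (p + 2) / 2 * (1 - Real.tanh (p / 2 * (s * x)) ^ 2)) *
        (2 / p - s * x * Real.tanh (p / 2 * (s * x))) ^ 2)
    + (4 - p) / (4 * p * s ^ 2)) * phi p ω x ^ 2 with hG'
  have hderiv : ∀ x, HasDerivAt G (G' x) x := by
    intro x
    have hT := hasDerivAt_tanh_mul (p / 2) s x
    have hx := hasDerivAt_id' x
    have hh := ((hx.const_mul s).fun_mul hT).const_sub (2 / p)
    have hk := ((hT.const_mul s).fun_neg.fun_sub ((hx.const_mul (p / 2 * s ^ 2)).fun_mul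
      ((hT.fun_pow 2).const_sub 1))).fun_sub ((hT.const_mul s).fun_mul hh)
    refine ((((hh.fun_mul hk).const_mul (1 / (4 * s ^ 4))).fun_sub
      (hx.div_const (4 * s ^ 2))).fun_mul ((hphi x).fun_pow 2)).congr_deriv ?_
    simp only [hG']
    generalize Real.tanh (p / 2 * (s * x)) = T
    generalize phi p ω x = F
    field_simp
    ring
  have hGint : Integrable G := by
    refine (hint (b₀ := fun T => 1 / (4 * s ^ 4) * (2 / p * (-(s * T) - s * T * (2 / p))))
      (b₁ := fun T => 1 / (4 * s ^ 4) * (2 / p * (-(p / 2 * s ^ 2 * (1 - T ^ 2)) + s ^ 2 * T ^ 2)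
        - s * T * (-(s * T) - s * T * (2 / p))) - 1 / (4 * s ^ 2))
      (b₂ := fun T => -(1 / (4 * s ^ 4)) * (s * T * (-(p / 2 * s ^ 2 * (1 - T ^ 2))
        + s ^ 2 * T ^ 2))) (by fun_prop) (by fun_prop) (by fun_prop)).congr
      (ae_of_all _ fun x => ?_)
    simp only [hG]
    ring
  have hGint' : Integrable G' := by
    refine (hint (b₀ := fun T => 1 / (4 * s ^ 4) * ((-(s * T) - s * T * (2 / p)) ^ 2
        + s ^ 2 * (1 - (p + 1) * (p + 2) / 2 * (1 - T ^ 2)) * (2 / p) ^ 2)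
        + (4 - p) / (4 * p * s ^ 2))
      (b₁ := fun T => 1 / (4 * s ^ 4) * (2 * (-(s * T) - s * T * (2 / p))
          * (-(p / 2 * s ^ 2 * (1 - T ^ 2)) + s ^ 2 * T ^ 2)
        - s ^ 2 * (1 - (p + 1) * (p + 2) / 2 * (1 - T ^ 2)) * (2 * (2 / p) * (s * T))))
      (b₂ := fun T => 1 / (4 * s ^ 4) * ((-(p / 2 * s ^ 2 * (1 - T ^ 2)) + s ^ 2 * T ^ 2) ^ 2
        + s ^ 2 * (1 - (p + 1) * (p + 2) / 2 * (1 - T ^ 2)) * (s * T) ^ 2))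
      (by fun_prop) (by fun_prop) (by fun_prop)).congr (ae_of_all _ fun x => ?_)
    simp only [hG']
    ring
  have hzero := integral_eq_zero_of_hasDerivAt_of_integrable hderiv hGint' hGint
  have hB : Bpsi p ω =
      ∫ x, (G' x + -((4 - p) / (4 * p * (1 - ω ^ 2))) * phi p ω x ^ 2) := by
    unfold Bpsi
    congr 1
    ext x
    have h2 : psi2 p ω x = -ω * psi1 p ω x := by simp only [psi1, psi2]; ring
    rw [h2, (hasDerivAt_psi1 hp hω hc x hs rfl).deriv, phi_rpow hp hc, psi1_eq hp hω hc]
    simp only [hG', ← hs]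
    have hω2 : ω ^ 2 = 1 - s ^ 2 := by linarith
    generalize Real.tanh (p / 2 * (s * x)) = T
    generalize phi p ω x = F
    rw [← hsq]
    have hcol : ∀ A B : ℝ, A + B ^ 2 - (p + 1) * ((p + 2) * s ^ 2 / 2 * (1 - T ^ 2)) * B ^ 2
        + 2 * ω * B * (-ω * B) + (-ω * B) ^ 2
        = A + s ^ 2 * B ^ 2 - (p + 1) * ((p + 2) * s ^ 2 / 2 * (1 - T ^ 2)) * B ^ 2 := by
      intro A B
      linear_combination -(B ^ 2) * hω2
    rw [hcol]
    field_simp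
    ring
  rw [hB, integral_add hGint' ((integrable_phi_sq hp hc).const_mul _), hzero, zero_add,
    integral_const_mul]

theorem integral_phi_sq_pos {p ω : ℝ} (hp : 0 < p) (hc : 0 < 1 - ω ^ 2) :
    0 < ∫ x, phi p ω x ^ 2 := by
  have hpos : ∀ x, 0 < phi p ω x := fun x => by
    rw [phi_eq]
    have := profile_pos p (√(1 - ω ^ 2) * x)
    positivity
  rw [integral_pos_iff_support_of_nonneg (fun x => sq_nonneg _) (integrable_phi_sq hp hc)]
  have hsupp : (Function.support fun x => phi p ω x ^ 2) = Set.univ :=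
    Set.eq_univ_of_forall fun x => pow_ne_zero 2 (hpos x).ne'
  simp [hsupp]

/-- At the critical frequency `ω² = p/4`: the map `λ ↦ ∫ φ_λ²` has derivative
`-(1/ω)∫φ_ω²` at `λ = ω`, and consequently
`⟨S_ω''(Φ_ω)ψ_ω, ψ_ω⟩ = (1/(4ω))·(d/dλ)∫φ_λ²|_{λ=ω} = -(1/(4ω²))∫φ_ω² < 0`. -/
theorem hessian_negative_at_psi (p ω : ℝ) (hp : 0 < p) (hp4 : p < 4)
    (hω1 : -1 < ω) (hω2 : ω < 1) (hcrit : ω ^ 2 = p / 4) :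
    HasDerivAt (fun l : ℝ => ∫ x : ℝ, (phi p l x) ^ 2)
      (-(1 / ω) * ∫ x : ℝ, (phi p ω x) ^ 2) ω ∧
    Bpsi p ω = (1 / (4 * ω)) * deriv (fun l : ℝ => ∫ x : ℝ, (phi p l x) ^ 2) ω ∧
    Bpsi p ω = -(1 / (4 * ω ^ 2)) * ∫ x : ℝ, (phi p ω x) ^ 2 ∧
    Bpsi p ω < 0 := by
  have hω0 : ω ≠ 0 := by
    rintro rfl
    norm_num at hcrit
    linarith
  have hc : 1 - ω ^ 2 = (4 - p) / 4 := by rw [hcrit]; ring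
  have hc0 : 0 < 1 - ω ^ 2 := by rw [hc]; linarith
  have hd : 4 - p ≠ 0 := by linarith
  have hpos := integral_phi_sq_pos hp hc0
  have hD : HasDerivAt (fun l : ℝ => ∫ x : ℝ, (phi p l x) ^ 2)
      (-(1 / ω) * ∫ x : ℝ, (phi p ω x) ^ 2) ω := by
    refine (hasDerivAt_integral_phi_sq hp hc0).congr_deriv ?_
    rw [hc]
    congr 2
    field_simp
    linarith
  have hB : Bpsi p ω = -(1 / (4 * ω ^ 2)) * ∫ x : ℝ, (phi p ω x) ^ 2 := by
    rw [Bpsi_eq hp hω0 hc0, hc]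
    congr 2
    field_simp
    linarith
  refine ⟨hD, ?_, hB, ?_⟩
  · rw [hD.deriv, hB]
    field_simp
  · rw [hB]
    have : 0 < 1 / (4 * ω ^ 2) := by positivity
    nlinarith
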